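/- Let p be an odd prime and D a finite abelian p-group with non-degenerate quadratic form q such that D = ⟨β⟩ ⊕ ⟨γ⟩ is an orthogonal sum of two cyclic subgroups generated by anisotropic (or trivial) elements β, γ. Then γ^⊥ = ⟨β⟩ contains at most one isotropic subgroup of order p, and consequently e^γ ∉ im(↑). -/

import Mathlib

open scoped Classical BigOperators

noncomputable section

/-- The bilinear form associated to a quadratic form `q : D → ℚ/ℤ`. -/
def bil {D : Type*} [AddCommGroup D] (q : D → AddCircle (1 : ℚ)) (x y : D) :
    AddCircle (1 : ℚ) :=
  q (x + y) - q x - q y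

/-- The standard basis vector `e^γ` of `ℂ[D]`. -/
def eV {D : Type*} (γ : D) : D → ℂ := fun β => if β = γ then 1 else 0

/-- `↑_H(e^{γ+H}) = ∑_{μ ∈ H} e^{γ+μ}`, as an element of `ℂ[D]`. -/
def liftVec {D : Type*} [AddCommGroup D] (H : AddSubgroup D) (γ : D) : D → ℂ :=
  fun β => if β - γ ∈ H then 1 else 0

/-- `im(↑) = ∑_H im(↑_H)`, the span of all isotropic lifts over nontrivial
isotropic subgroups `H` of `D`. -/
def imUp {D : Type*} [AddCommGroup D] (q : D → AddCircle (1 : ℚ)) :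
    Submodule ℂ (D → ℂ) :=
  Submodule.span ℂ
    {v | ∃ H : AddSubgroup D, H ≠ ⊥ ∧ (∀ x ∈ H, q x = 0) ∧
      ∃ γ : D, (∀ μ ∈ H, bil q γ μ = 0) ∧ v = liftVec H γ}

/-- In the cyclic subgroup generated by `β`, every `p`-torsion element is a multiple of any given
nonzero `p`-torsion element. -/
theorem mem_zmultiples_of_prime_nsmul_eq_zero {D : Type*} [AddCommGroup D] {p : ℕ}
    (hp : p.Prime) {β x y : D} (hx : x ∈ AddSubgroup.zmultiples β)
    (hy : y ∈ AddSubgroup.zmultiples β) (hx0 : x ≠ 0) (hpx : p • x = 0) (hpy : p • y = 0) :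
    y ∈ AddSubgroup.zmultiples x := by
  obtain ⟨a, rfl⟩ := AddSubgroup.mem_zmultiples_iff.1 hx
  obtain ⟨b, rfl⟩ := AddSubgroup.mem_zmultiples_iff.1 hy
  have hp' : Prime (p : ℤ) := Nat.prime_iff_prime_int.1 hp
  rw [← natCast_zsmul, ← mul_zsmul, ← addOrderOf_dvd_iff_zsmul_eq_zero] at hpx hpy
  rw [Ne, ← addOrderOf_dvd_iff_zsmul_eq_zero] at hx0
  have hpn : (p : ℤ) ∣ addOrderOf β := by
    by_contra h
    exact hx0 (((hp'.coprime_iff_not_dvd.2 h).symm).dvd_of_dvd_mul_left hpx)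
  obtain ⟨n, hn⟩ := hpn
  rw [hn] at hpx hpy hx0
  obtain ⟨a, rfl⟩ := (mul_dvd_mul_iff_left hp'.ne_zero).1 hpx
  obtain ⟨b, rfl⟩ := (mul_dvd_mul_iff_left hp'.ne_zero).1 hpy
  have hpa : ¬ (p : ℤ) ∣ a := fun ⟨c, hc⟩ => hx0 ⟨c, by rw [hc]; ring⟩
  obtain ⟨u, v, huv⟩ := hp'.coprime_iff_not_dvd.2 hpa
  refine AddSubgroup.mem_zmultiples_iff.2 ⟨b * v, ?_⟩
  rw [← mul_zsmul, ← sub_eq_zero, ← sub_smul, ← addOrderOf_dvd_iff_zsmul_eq_zero, hn]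
  exact ⟨-(b * u), by linear_combination n * b * huv⟩

/-- A nontrivial subgroup of a group of exponent dividing `p ^ k` has a nonzero `p`-torsion
element. -/
theorem exists_mem_ne_zero_prime_nsmul_eq_zero {D : Type*} [AddCommGroup D] {p k : ℕ}
    (hexp : ∀ x : D, p ^ k • x = 0) {H : AddSubgroup D} (hH : H ≠ ⊥) :
    ∃ x ∈ H, x ≠ 0 ∧ p • x = 0 := by
  obtain ⟨h, hhH, hh0⟩ := H.bot_or_exists_ne_zero.resolve_left hH
  have key : ∀ n : ℕ, p ^ n • h = 0 → ∃ x ∈ H, x ≠ 0 ∧ p • x = 0 := by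
    intro n
    induction n with
    | zero => intro hn; exact absurd (by simpa using hn) hh0
    | succ n ih =>
      intro hn
      by_cases h0 : p ^ n • h = 0
      · exact ih h0
      · exact ⟨p ^ n • h, H.nsmul_mem hhH _, h0, by rw [← mul_nsmul, ← pow_succ, hn]⟩
  exact key k (hexp h)

/-- A subgroup of prime order `p` is generated by a nonzero `p`-torsion element. -/
theorem AddSubgroup.eq_zmultiples_of_card_eq_prime {D : Type*} [AddCommGroup D] {p : ℕ}
    (hp : p.Prime) {H : AddSubgroup D} (hH : Nat.card H = p) :
    ∃ x ∈ H, x ≠ 0 ∧ p • x = 0 ∧ H = AddSubgroup.zmultiples x := by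
  have := Fact.mk hp
  have hne : H ≠ ⊥ := by
    rintro rfl
    exact hp.one_lt.ne (by simpa using hH)
  obtain ⟨x, hx0⟩ := (AddSubgroup.ne_bot_iff_exists_ne_zero (H := H)).1 hne
  refine ⟨x, x.2, fun h => hx0 (Subtype.ext h), ?_, le_antisymm ?_ ?_⟩
  · have := card_nsmul_eq_zero' (x := x)
    rw [hH] at this
    simpa using congrArg (Subtype.val) this
  · intro y hy
    obtain ⟨m, hm⟩ := AddSubgroup.mem_zmultiples_iff.1
      (mem_zmultiples_of_prime_card hH hx0 (g' := ⟨y, hy⟩))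
    exact AddSubgroup.mem_zmultiples_iff.2 ⟨m, by simpa using congrArg Subtype.val hm⟩
  · simp

theorem bil_comm {D : Type*} [AddCommGroup D] (q : D → AddCircle (1 : ℚ)) (x y : D) :
    bil q x y = bil q y x := by
  simp only [bil, add_comm x y]
  abel

/-- If every isotropic lift contains `x` in its support exactly when it contains `y`, then every
vector of `im(↑)` takes equal values at `x` and `y`. -/
theorem apply_eq_of_mem_imUp {D : Type*} [AddCommGroup D] {q : D → AddCircle (1 : ℚ)} {x y : D}
    (h : ∀ (H : AddSubgroup D) (δ : D), H ≠ ⊥ → (∀ μ ∈ H, q μ = 0) →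
      (∀ μ ∈ H, bil q δ μ = 0) → (x - δ ∈ H ↔ y - δ ∈ H))
    {v : D → ℂ} (hv : v ∈ imUp q) : v x = v y := by
  induction hv using Submodule.span_induction with
  | mem v hv =>
    obtain ⟨H, hH, hq, δ, hδ, rfl⟩ := hv
    simp only [liftVec, h H δ hH hq hδ]
  | zero => rfl
  | add u v _ _ hu hv => simp [hu, hv]
  | smul c v _ hv => simp [hv]

/-- If no isotropic lift is supported at `x`, then every vector of `im(↑)` vanishes at `x`. -/
theorem apply_eq_zero_of_mem_imUp {D : Type*} [AddCommGroup D] {q : D → AddCircle (1 : ℚ)} {x : D}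
    (h : ∀ (H : AddSubgroup D) (δ : D), H ≠ ⊥ → (∀ μ ∈ H, q μ = 0) →
      (∀ μ ∈ H, bil q δ μ = 0) → x - δ ∉ H)
    {v : D → ℂ} (hv : v ∈ imUp q) : v x = 0 := by
  induction hv using Submodule.span_induction with
  | mem v hv =>
    obtain ⟨H, hH, hq, δ, hδ, rfl⟩ := hv
    simp only [liftVec, h H δ hH hq hδ, if_false]
  | zero => rfl
  | add u v _ _ hu hv => simp [hu, hv]
  | smul c v _ hv => simp [hv]

/-- Let `p` be an odd prime and `D` a finite abelian `p`-group with non-degenerate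
quadratic form `q` such that `D = ⟨β⟩ ⊕ ⟨γ⟩` is an orthogonal sum of two cyclic
subgroups generated by anisotropic (or trivial) elements `β, γ`.  Then
`γ^⊥ = ⟨β⟩` contains at most one isotropic subgroup of order `p`, and
consequently `e^γ ∉ im(↑)`. -/
theorem basisVec_not_mem_imUp_of_rank_le_two
    {D : Type*} [AddCommGroup D] [Fintype D] (p : ℕ) (hp : p.Prime) (hodd : p ≠ 2)
    (q : D → AddCircle (1 : ℚ))
    (hquad : ∀ (m : ℤ) (x : D), q (m • x) = (m ^ 2 : ℤ) • q x)
    (hbil : ∀ x y z : D, bil q (x + y) z = bil q x z + bil q y z)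
    (hnd : ∀ x : D, (∀ y : D, bil q x y = 0) → x = 0)
    (hexp : ∃ k : ℕ, ∀ x : D, p ^ k • x = 0)
    (β γ : D)
    (hsup : AddSubgroup.zmultiples β ⊔ AddSubgroup.zmultiples γ = ⊤)
    (hinf : AddSubgroup.zmultiples β ⊓ AddSubgroup.zmultiples γ = ⊥)
    (horth : bil q β γ = 0)
    (haniβ : β = 0 ∨ q β ≠ 0)
    (haniγ : γ = 0 ∨ q γ ≠ 0) :
    ({x : D | bil q γ x = 0} = (AddSubgroup.zmultiples β : Set D)) ∧
    (∀ H₁ H₂ : AddSubgroup D,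
      Nat.card H₁ = p → (∀ x ∈ H₁, q x = 0) → (∀ x ∈ H₁, bil q γ x = 0) →
      Nat.card H₂ = p → (∀ x ∈ H₂, q x = 0) → (∀ x ∈ H₂, bil q γ x = 0) →
      H₁ = H₂) ∧
    eV γ ∉ imUp q := by
  obtain ⟨k, hexp⟩ := hexp
  have hbilr (x y z : D) : bil q x (y + z) = bil q x y + bil q x z := by
    rw [bil_comm, hbil, bil_comm q y, bil_comm q z]
  let B (x : D) : D →+ AddCircle (1 : ℚ) := AddMonoidHom.mk' (bil q x) (hbilr x)
  have hzsmul (x y : D) (m : ℤ) : bil q x (m • y) = m • bil q x y := map_zsmul (B x) m y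
  have hdec (x : D) : ∃ a b : ℤ, a • β + b • γ = x := by
    have hx : x ∈ AddSubgroup.zmultiples β ⊔ AddSubgroup.zmultiples γ := hsup ▸ AddSubgroup.mem_top x
    obtain ⟨y, hy, z, hz, rfl⟩ := AddSubgroup.mem_sup.1 hx
    obtain ⟨a, rfl⟩ := AddSubgroup.mem_zmultiples_iff.1 hy
    obtain ⟨b, rfl⟩ := AddSubgroup.mem_zmultiples_iff.1 hz
    exact ⟨a, b, rfl⟩
  have horth' : bil q γ β = 0 := by rw [bil_comm, horth]
  have hperp (x : D) : bil q γ x = 0 ↔ x ∈ AddSubgroup.zmultiples β := by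
    constructor
    · intro hx
      obtain ⟨a, b, rfl⟩ := hdec x
      rw [hbilr, hzsmul, horth', smul_zero, zero_add] at hx
      have hb : b • γ = 0 := by
        refine hnd _ fun y => ?_
        obtain ⟨c, d, rfl⟩ := hdec y
        rw [hbilr, hzsmul, hzsmul, bil_comm q _ β, hzsmul, horth, bil_comm q _ γ, hx]
        simp
      rw [hb, add_zero]
      exact AddSubgroup.zsmul_mem_zmultiples β a
    · intro hx
      obtain ⟨a, rfl⟩ := AddSubgroup.mem_zmultiples_iff.1 hx
      rw [hzsmul, horth', smul_zero]
  refine ⟨Set.ext hperp, ?_, ?_⟩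
  · intro H₁ H₂ hc₁ _ ho₁ hc₂ _ ho₂
    obtain ⟨x, hx, hx0, hpx, rfl⟩ := AddSubgroup.eq_zmultiples_of_card_eq_prime hp hc₁
    obtain ⟨y, hy, hy0, hpy, rfl⟩ := AddSubgroup.eq_zmultiples_of_card_eq_prime hp hc₂
    have hxβ := (hperp x).1 (ho₁ x hx)
    have hyβ := (hperp y).1 (ho₂ y hy)
    refine le_antisymm ?_ ?_ <;> rw [AddSubgroup.zmultiples_le]
    · exact mem_zmultiples_of_prime_nsmul_eq_zero hp hyβ hxβ hy0 hpy hpx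
    · exact mem_zmultiples_of_prime_nsmul_eq_zero hp hxβ hyβ hx0 hpx hpy
  · intro hmem
    have hsupp (H : AddSubgroup D) (δ ε x : D) (hq : ∀ μ ∈ H, q μ = 0)
        (hδ : ∀ μ ∈ H, bil q δ μ = 0) (hε : ε - δ ∈ H) (hx : x ∈ H) : bil q ε x = 0 := by
      rw [← sub_add_cancel ε δ, hbil, hδ x hx, bil, hq _ (H.add_mem hε hx), hq _ hε, hq _ hx]
      simp
    by_cases hκ : ∃ κ ∈ AddSubgroup.zmultiples β, κ ≠ 0 ∧ p • κ = 0 ∧ q κ = 0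
    · obtain ⟨κ, hκβ, hκ0, hpκ, hqκ⟩ := hκ
      have hκκ : bil q κ κ = 0 := by
        have h2 := hquad 2 κ
        rw [two_zsmul, hqκ, smul_zero] at h2
        rw [bil, h2, hqκ]
        simp
      have heq := apply_eq_of_mem_imUp (x := γ) (y := γ + κ) ?_ hmem
      · simp [eV, hκ0] at heq
      intro H δ hH hq hδ
      obtain ⟨x, hxH, hx0, hpx⟩ := exists_mem_ne_zero_prime_nsmul_eq_zero hexp hH
      have hκH (hx : bil q γ x = 0) : κ ∈ H := by
        have := mem_zmultiples_of_prime_nsmul_eq_zero hp ((hperp x).1 hx) hκβ hx0 hpx hpκ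
        exact (AddSubgroup.zmultiples_le.2 hxH) this
      rw [add_sub_right_comm]
      constructor
      · intro h
        exact H.add_mem h (hκH (hsupp H δ γ x hq hδ h hxH))
      · intro h
        have hx := hsupp H δ (γ + κ) x hq hδ (by rwa [add_sub_right_comm]) hxH
        rw [hbil] at hx
        suffices hκx : bil q κ x = 0 by
          rw [hκx, add_zero] at hx
          exact (H.add_mem_cancel_right (hκH hx)).1 h
        obtain ⟨a, b, rfl⟩ := hdec x
        have hpa : p • a • β = 0 := by
          rw [← AddSubgroup.mem_bot, ← hinf, AddSubgroup.mem_inf]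
          refine ⟨AddSubgroup.nsmul_mem _ (AddSubgroup.zsmul_mem_zmultiples β a) p, ?_⟩
          rw [smul_add] at hpx
          rw [eq_neg_of_add_eq_zero_left hpx]
          exact neg_mem (AddSubgroup.nsmul_mem _ (AddSubgroup.zsmul_mem_zmultiples γ b) p)
        obtain ⟨m, hm⟩ := AddSubgroup.mem_zmultiples_iff.1
          (mem_zmultiples_of_prime_nsmul_eq_zero hp hκβ
            (AddSubgroup.zsmul_mem_zmultiples β a) hκ0 hpκ hpa)
        rw [hbilr, ← hm, hzsmul, hzsmul, hκκ, bil_comm q κ γ, (hperp κ).2 hκβ]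
        simp
    · have hz := apply_eq_zero_of_mem_imUp (x := γ) ?_ hmem
      · simp [eV] at hz
      intro H δ hH hq hδ h
      obtain ⟨x, hxH, hx0, hpx⟩ := exists_mem_ne_zero_prime_nsmul_eq_zero hexp hH
      exact hκ ⟨x, (hperp x).1 (hsupp H δ γ x hq hδ h hxH), hx0, hpx, hq x hxH⟩
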